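/- For every multi-index m ∈ ℕ_0^n with |m| ≥ 3 and |m| odd, the series G_m(x) = Σ_{(α,ω) ∈ ℤ×ℤ^{n−1} \ {(0,0)}} q^{(1)}_m(αx + ω) converges normally on H⁺(ℝⁿ) and defines a left monogenic function there that is invariant under all translations x ↦ x + ω with ω ∈ ℤ^{n−1} = ℤe_1 + … + ℤe_{n−1}, and G_m is bounded on the set {x ∈ H⁺(ℝⁿ) : x_n ≥ 1}. -/

import Mathlib

noncomputable section

open CliffordAlgebra Filter

attribute [local instance] Classical.propDecidable

/-- The quadratic form `-(x₁² + ⋯ + xₙ²)` on `ℝⁿ`, so that in the associated Clifford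
algebra one has `x * x = -‖x‖²`, i.e. `eᵢeⱼ + eⱼeᵢ = -2δᵢⱼ`. -/
def Qf (n : ℕ) : QuadraticForm ℝ (Fin n → ℝ) :=
  QuadraticMap.weightedSumSquares ℝ (fun _ : Fin n => (-1 : ℝ))

/-- The real Clifford algebra `Cl_n`. -/
abbrev Cl (n : ℕ) := CliffordAlgebra (Qf n)

/-- The embedding of a vector of `ℝⁿ` into `Cl_n`. -/
def clVec {n : ℕ} (x : Fin n → ℝ) : Cl n := CliffordAlgebra.ι (Qf n) x

/-- The canonical basis vectors `e_i` inside `Cl_n` (0-indexed: `eCl i` is `e_{i+1}`). -/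
def eCl {n : ℕ} (i : Fin n) : Cl n := clVec (Pi.single i 1)

/-- The reversion anti-automorphism `a ↦ a*`. -/
def clRev {n : ℕ} (a : Cl n) : Cl n := CliffordAlgebra.reverse a

/-- The conjugation anti-automorphism `a ↦ ā` (reversion composed with grade involution). -/
def clConj {n : ℕ} (a : Cl n) : Cl n := CliffordAlgebra.reverse (CliffordAlgebra.involute a)

/-- `(a*)‾`, the conjugate of the reversion of `a`. -/
def crev {n : ℕ} (a : Cl n) : Cl n := clConj (clRev a)

/-- The scalar part `Sc a` of a Clifford number (the coefficient of `e_∅ = 1`). -/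
def Sc {n : ℕ} (a : Cl n) : ℝ :=
  ExteriorAlgebra.algebraMapInv ((CliffordAlgebra.equivExterior (Qf n)) a)

/-- The vector (grade-one) part of a Clifford number, as an element of `ℝⁿ`. -/
def vecPart {n : ℕ} (a : Cl n) : Fin n → ℝ :=
  ExteriorAlgebra.ιInv ((CliffordAlgebra.equivExterior (Qf n)) a)

/-- The Clifford norm `‖a‖ = (Σ_A a_A²)^{1/2} = (Sc (a ā))^{1/2}`. -/
def clNorm {n : ℕ} (a : Cl n) : ℝ := Real.sqrt (Sc (a * clConj a))

/-- The last ("vertical") coordinate `x_n` of a vector `x ∈ ℝⁿ`. -/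
def lastc (n : ℕ) (x : Fin n → ℝ) : ℝ :=
  if h : 0 < n then x ⟨n - 1, by omega⟩ else 0

/-- The upper half-space `H⁺(ℝⁿ) = {x ∈ ℝⁿ : x_n > 0}`. -/
def upH (n : ℕ) : Set (Fin n → ℝ) := {x | 0 < lastc n x}

/-- Replace the last coordinate of `x` by `t`. -/
def setLast {n : ℕ} (x : Fin n → ℝ) (t : ℝ) : Fin n → ℝ :=
  fun j => if (j : ℕ) = n - 1 then t else x j

/-- The last basis vector `e_n` of `ℝⁿ`. -/
def enVec (n : ℕ) : Fin n → ℝ := fun j => if (j : ℕ) = n - 1 then 1 else 0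

/-- `ω ∈ ℤ^{n-1} = ℤe₁ + ⋯ + ℤe_{n-1}`: an integer vector with vanishing last coordinate. -/
def horPart (n : ℕ) (ω : Fin n → ℤ) : Prop := ∀ j : Fin n, (j : ℕ) = n - 1 → ω j = 0

/-- The real vector associated to an integer lattice point. -/
def latVec {n : ℕ} (ω : Fin n → ℤ) : Fin n → ℝ := fun j => (ω j : ℝ)

/-- The vertical strip `V_ε(H⁺(ℝⁿ))`. -/
def Vstrip (n : ℕ) (ε : ℝ) : Set (Fin n → ℝ) :=
  {x | clNorm (clVec (setLast x 0)) ≤ 1 / ε ∧ ε < lastc n x}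

/-- The kernel `q^{(s)}_0`, evaluated on a Clifford number:
`q^{(s)}_0(a) = a/‖a‖^{n+1-s}` for odd `s`, `q^{(s)}_0(a) = 1/‖a‖^{n-s}` for even `s`. -/
def qker {n : ℕ} (s : ℕ) (a : Cl n) : Cl n :=
  if Odd s then ((clNorm a) ^ (n + 1 - s))⁻¹ • a
  else algebraMap ℝ (Cl n) ((clNorm a ^ (n - s))⁻¹)

/-- `q^{(s)}_0` as a function on `ℝⁿ`. -/
def qfun {n : ℕ} (s : ℕ) (x : Fin n → ℝ) : Cl n := qker s (clVec x)

/-- The `i`-th partial derivative of a `Cl_n`-valued function, detected componentwise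
through all real-linear functionals. -/
def clPDeriv {n : ℕ} (i : Fin n) (f : (Fin n → ℝ) → Cl n) (x : Fin n → ℝ) : Cl n :=
  if h : ∃ v : Cl n, ∀ φ : Cl n →ₗ[ℝ] ℝ,
      HasDerivAt (fun t : ℝ => φ (f (Function.update x i (x i + t)))) (φ v) 0
  then h.choose else 0

/-- The (left) Euclidean Dirac operator `D f = Σ eᵢ ∂f/∂xᵢ`. -/
def Dirac {n : ℕ} (f : (Fin n → ℝ) → Cl n) (x : Fin n → ℝ) : Cl n :=
  ∑ i : Fin n, eCl i * clPDeriv i f x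

/-- The right Euclidean Dirac operator `f D = Σ (∂f/∂xᵢ) eᵢ`. -/
def DiracR {n : ℕ} (f : (Fin n → ℝ) → Cl n) (x : Fin n → ℝ) : Cl n :=
  ∑ i : Fin n, clPDeriv i f x * eCl i

/-- The iterated Dirac operator `D^s`. -/
def DiracIter {n : ℕ} : ℕ → ((Fin n → ℝ) → Cl n) → ((Fin n → ℝ) → Cl n)
  | 0, f => f
  | (s + 1), f => Dirac (DiracIter s f)

/-- The iterated right Dirac operator. -/
def DiracRIter {n : ℕ} : ℕ → ((Fin n → ℝ) → Cl n) → ((Fin n → ℝ) → Cl n)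
  | 0, f => f
  | (s + 1), f => DiracR (DiracRIter s f)

/-- The `i`-th partial derivative of a real-valued function. -/
def pdR {n : ℕ} (i : Fin n) (g : (Fin n → ℝ) → ℝ) (x : Fin n → ℝ) : ℝ :=
  deriv (fun t : ℝ => g (Function.update x i (x i + t))) 0

/-- Iterated partial derivative in one fixed direction. -/
def clPDerivIter {n : ℕ} (i : Fin n) : ℕ → ((Fin n → ℝ) → Cl n) → ((Fin n → ℝ) → Cl n)
  | 0, f => f
  | (k + 1), f => clPDeriv i (clPDerivIter i k f)

/-- The mixed partial derivative `∂^{|m|}/∂x^m` for a multi-index `m ∈ ℕ₀ⁿ`. -/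
def multiPDeriv {n : ℕ} (m : Fin n → ℕ) (f : (Fin n → ℝ) → Cl n) : (Fin n → ℝ) → Cl n :=
  (List.finRange n).foldr (fun i g => clPDerivIter i (m i) g) f

/-- Convergence of a series of Clifford numbers to `a`, detected componentwise through
all real-linear functionals. -/
def HasClSum {n : ℕ} {ι : Type*} (g : ι → Cl n) (a : Cl n) : Prop :=
  ∀ φ : Cl n →ₗ[ℝ] ℝ, HasSum (fun i => φ (g i)) (φ a)

/-- Index set for the Eisenstein series `G_m`: `(α,ω) ∈ ℤ × ℤ^{n-1}`, `(α,ω) ≠ (0,0)`. -/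
def GmIdx (n : ℕ) : Type := {v : ℤ × (Fin n → ℤ) // horPart n v.2 ∧ v ≠ 0}

/-- The summand `q^{(1)}_m(αx + ω)` of the monogenic Eisenstein series `G_m`. -/
def Gterm {n : ℕ} (m : Fin n → ℕ) (x : Fin n → ℝ) (v : GmIdx n) : Cl n :=
  multiPDeriv m (qfun 1) ((v.1.1 : ℝ) • x + latVec v.1.2)

/-- The monogenic Eisenstein series `G_m(x) = Σ_{(α,ω) ≠ 0} q^{(1)}_m(αx + ω)`. -/
def Gm {n : ℕ} (m : Fin n → ℕ) (x : Fin n → ℝ) : Cl n :=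
  if h : ∃ a : Cl n, HasClSum (Gterm m x) a then h.choose else 0
/-- The group of invertible `2 × 2` matrices with entries in `Cl_n`. -/
abbrev GL2 (n : ℕ) := (Matrix (Fin 2) (Fin 2) (Cl n))ˣ

/-- The `(i,j)` entry of an invertible Clifford matrix. -/
def ent {n : ℕ} (M : GL2 n) (i j : Fin 2) : Cl n :=
  M.val i j

/-- The translation matrix `T_b = (1, b; 0, 1)`. -/
def Tmat {n : ℕ} (b : Cl n) : GL2 n where
  val := !![1, b; 0, 1]
  inv := !![1, -b; 0, 1]
  val_inv := by
    ext i j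
    fin_cases i <;> fin_cases j <;>
      simp [Matrix.mul_apply, Fin.sum_univ_two, Matrix.one_apply]
  inv_val := by
    ext i j
    fin_cases i <;> fin_cases j <;>
      simp [Matrix.mul_apply, Fin.sum_univ_two, Matrix.one_apply]

/-- The inversion matrix `J = (0, -1; 1, 0)`. -/
def Jmat (n : ℕ) : GL2 n where
  val := !![0, -1; 1, 0]
  inv := !![0, 1; -1, 0]
  val_inv := by
    ext i j
    fin_cases i <;> fin_cases j <;>
      simp [Matrix.mul_apply, Fin.sum_univ_two, Matrix.one_apply]
  inv_val := by
    ext i j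
    fin_cases i <;> fin_cases j <;>
      simp [Matrix.mul_apply, Fin.sum_univ_two, Matrix.one_apply]

/-- The special hypercomplex modular group `Γ_p = ⟨T_{e_1}, …, T_{e_p}, J⟩`. -/
def Gamma (n p : ℕ) : Subgroup (GL2 n) :=
  Subgroup.closure ({Jmat n} ∪ {M | ∃ i : Fin n, (i : ℕ) < p ∧ M = Tmat (eCl i)})

/-- The standard order `O_p = Σ_{A ⊆ {1,…,p}} ℤ e_A` in `Cl_n`: the subring generated by
`e_1, …, e_p`. -/
def Op (n p : ℕ) : Set (Cl n) :=
  Subring.closure {a : Cl n | ∃ i : Fin n, (i : ℕ) < p ∧ a = eCl i}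

/-- `a ∈ N·O_p`. -/
def inNOp (n p N : ℕ) (a : Cl n) : Prop := ∃ y ∈ Op n p, a = (N : ℕ) • y

/-- The principal congruence subgroup `Γ_p[N]` of level `N` (as a set of matrices). -/
def GammaN (n p N : ℕ) : Set (GL2 n) :=
  {M | M ∈ Gamma n p ∧ inNOp n p N (ent M 0 0 - 1) ∧ inNOp n p N (ent M 0 1) ∧
    inNOp n p N (ent M 1 0) ∧ inNOp n p N (ent M 1 1 - 1)}

/-- The congruence group `Γ_p^0[N] = {M ∈ Γ_p : b ∈ N·O_p}`. -/
def Gamma0Upper (n p N : ℕ) : Set (GL2 n) :=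
  {M | M ∈ Gamma n p ∧ inNOp n p N (ent M 0 1)}

/-- The congruence group `Γ_{p,0}[N] = {M ∈ Γ_p : c ∈ N·O_p}`. -/
def Gamma0Lower (n p N : ℕ) : Set (GL2 n) :=
  {M | M ∈ Gamma n p ∧ inNOp n p N (ent M 1 0)}

/-- The generalized theta group `Γ_{p,θ} = Γ_p[2] ∪ Γ_p[2]·J`. -/
def GammaTheta (n p : ℕ) : Set (GL2 n) :=
  GammaN n p 2 ∪ (fun M => M * Jmat n) '' GammaN n p 2

/-- `Λ` is a congruence subgroup of `Γ_p`: `Γ_p[N] ⊆ Λ ⊆ Γ_p` for some `N ≥ 1`. -/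
def IsCongruence (n p : ℕ) (Λ : Subgroup (GL2 n)) : Prop :=
  ∃ N : ℕ, 0 < N ∧ GammaN n p N ⊆ (Λ : Set (GL2 n)) ∧ (Λ : Set (GL2 n)) ⊆ Gamma n p

/-- `M` is a translation matrix `(1, b; 0, 1)`. -/
def IsTransMat {n : ℕ} (M : GL2 n) : Prop :=
  ∃ b : Cl n, M.val = !![1, b; 0, 1]

/-- `R : ι → GL2 n` is a system of representatives for the right cosets `T(Λ)\Λ` of the
subgroup of translation matrices `T(Λ)` contained in `Λ`: each member of `Λ` can be written
uniquely as `T * R i` with `T` a translation matrix of `Λ`. -/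
def IsRepSystem (n : ℕ) (Λ : Subgroup (GL2 n)) (ι : Type*) (R : ι → GL2 n) : Prop :=
  (∀ i, R i ∈ Λ) ∧
  (∀ M ∈ Λ, ∃! i : ι, ∃ T : GL2 n, IsTransMat T ∧ T ∈ Λ ∧ M = T * R i)

/-- The Möbius transformation `M⟨x⟩ = (ax+b)(cx+d)⁻¹` associated with a Clifford matrix,
as a map on `ℝⁿ`. -/
def mobius {n : ℕ} (M : GL2 n) (x : Fin n → ℝ) : Fin n → ℝ :=
  vecPart ((ent M 0 0 * clVec x + ent M 0 1) *
    Ring.inverse (ent M 1 0 * clVec x + ent M 1 1))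

/-- `a` is a (finite) product of vectors of `ℝⁿ`. -/
def IsProdVec {n : ℕ} (a : Cl n) : Prop :=
  ∃ l : List (Fin n → ℝ), a = (l.map (fun v => clVec v)).prod

/-- Membership in the general Vahlen group `GV(ℝⁿ)`. -/
def IsVahlen {n : ℕ} (M : Matrix (Fin 2) (Fin 2) (Cl n)) : Prop :=
  IsProdVec (M 0 0) ∧ IsProdVec (M 0 1) ∧ IsProdVec (M 1 0) ∧ IsProdVec (M 1 1) ∧
  (∃ r : ℝ, r ≠ 0 ∧ M 0 0 * clRev (M 1 1) - M 0 1 * clRev (M 1 0) = algebraMap ℝ (Cl n) r) ∧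
  (M 0 0 ≠ 0 → ∃ v : Fin n → ℝ, Ring.inverse (M 0 0) * M 0 1 = clVec v) ∧
  (M 1 0 ≠ 0 → ∃ v : Fin n → ℝ, Ring.inverse (M 1 0) * M 1 1 = clVec v)

open Topology

section smoothpart
open scoped ContDiff

lemma cl_dual_ext {n : ℕ} {a b : Cl n} (h : ∀ φ : Cl n →ₗ[ℝ] ℝ, φ a = φ b) : a = b := by
  rw [← sub_eq_zero]
  apply (Module.forall_dual_apply_eq_zero_iff ℝ (a - b)).1
  intro φ
  rw [map_sub, h φ, sub_self]

lemma HasClSum.uniq {n : ℕ} {ι : Type*} {g : ι → Cl n} {a b : Cl n}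
    (ha : HasClSum g a) (hb : HasClSum g b) : a = b :=
  cl_dual_ext fun φ => (ha φ).unique (hb φ)

lemma Gm_eq {n : ℕ} {m : Fin n → ℕ} {x : Fin n → ℝ} {a : Cl n}
    (ha : HasClSum (Gterm m x) a) : Gm m x = a := by
  have h : ∃ a : Cl n, HasClSum (Gterm m x) a := ⟨a, ha⟩
  unfold Gm
  rw [dif_pos h]
  exact h.choose_spec.uniq ha

/-- `clVec` as a linear map. -/
def clL (n : ℕ) : (Fin n → ℝ) →ₗ[ℝ] Cl n := CliffordAlgebra.ι (Qf n)

lemma clL_apply {n : ℕ} (x : Fin n → ℝ) : clL n x = clVec x := rfl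

/-- a functional on vectors, as a continuous linear map -/
def clF {n : ℕ} (φ : Cl n →ₗ[ℝ] ℝ) : (Fin n → ℝ) →L[ℝ] ℝ :=
  LinearMap.toContinuousLinearMap (φ ∘ₗ clL n)

lemma clF_apply {n : ℕ} (φ : Cl n →ₗ[ℝ] ℝ) (x : Fin n → ℝ) : clF φ x = φ (clVec x) := rfl

lemma hasClSum_clVec {n : ℕ} {ι : Type*} {g : ι → Fin n → ℝ} {a : Fin n → ℝ}
    (h : HasSum g a) : HasClSum (fun i => clVec (g i)) (clVec a) := by
  intro φ
  exact h.mapL (clF φ)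

lemma clVec_mul_self {n : ℕ} (x : Fin n → ℝ) :
    clVec x * clVec x = algebraMap ℝ (Cl n) (-∑ i, x i ^ 2) := by
  unfold clVec
  rw [CliffordAlgebra.ι_sq_scalar]
  congr 1
  simp [Qf, QuadraticMap.weightedSumSquares_apply, pow_two]

lemma clNorm_clVec {n : ℕ} (x : Fin n → ℝ) :
    clNorm (clVec x) = Real.sqrt (∑ i, x i ^ 2) := by
  unfold clNorm
  congr 1
  have h1 : clConj (clVec x) = - clVec x := by
    simp [clConj, clVec]
  rw [h1, mul_neg, clVec_mul_self, map_neg, neg_neg]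
  unfold Sc CliffordAlgebra.equivExterior CliffordAlgebra.changeFormEquiv
  simp only [LinearEquiv.coe_mk, LinearMap.coe_mk]
  erw [CliffordAlgebra.changeForm_algebraMap changeForm.associated_neg_proof]
  exact ExteriorAlgebra.algebraMap_leftInverse _ _

lemma clNorm_clVec_le {n : ℕ} (x : Fin n → ℝ) : clNorm (clVec x) ≤ n * ‖x‖ := by
  rw [clNorm_clVec]
  apply Real.sqrt_le_iff.2
  refine ⟨by positivity, ?_⟩
  calc ∑ i, x i ^ 2 ≤ ∑ i : Fin n, ‖x‖ ^ 2 := by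
        apply Finset.sum_le_sum
        intro i _
        rw [← sq_abs]
        gcongr
        exact norm_le_pi_norm x i
    _ = n * ‖x‖ ^ 2 := by simp
    _ ≤ (n * ‖x‖) ^ 2 := by
        rw [mul_pow]
        gcongr
        have : n ≤ n ^ 2 := Nat.le_self_pow (by norm_num) n
        exact_mod_cast this

lemma clPDeriv_eq {n : ℕ} {f : (Fin n → ℝ) → Cl n} {g : (Fin n → ℝ) → (Fin n → ℝ)}
    {g' : (Fin n → ℝ) →L[ℝ] (Fin n → ℝ)} {x : Fin n → ℝ}
    (hfg : ∀ᶠ y in 𝓝 x, f y = clVec (g y)) (hg : HasFDerivAt g g' x) (i : Fin n) :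
    clPDeriv i f x = clVec (g' (Pi.single i 1)) := by
  have hupd : ∀ t : ℝ, Function.update x i (x i + t) = x + t • (Pi.single i 1) := by
    intro t
    ext j
    by_cases hj : j = i
    · subst hj; simp
    · simp [hj]
  have key : ∀ φ : Cl n →ₗ[ℝ] ℝ,
      HasDerivAt (fun t : ℝ => φ (f (Function.update x i (x i + t))))
        (φ (clVec (g' (Pi.single i 1)))) 0 := by
    intro φ
    have hline : HasDerivAt (fun t : ℝ => x + t • (Pi.single i 1 : Fin n → ℝ))
        (Pi.single i 1) 0 := by
      have := ((hasDerivAt_id (0 : ℝ)).smul_const (Pi.single i 1 : Fin n → ℝ)).const_add x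
      simpa using this
    have h0 : x + (0 : ℝ) • (Pi.single i 1 : Fin n → ℝ) = x := by simp
    have hg2 : HasFDerivAt (fun y => clF φ (g y)) ((clF φ).comp g')
        (x + (0 : ℝ) • (Pi.single i 1 : Fin n → ℝ)) := by
      rw [h0]; exact (clF φ).hasFDerivAt.comp x hg
    have h1 := hg2.comp_hasDerivAt (0 : ℝ) hline
    refine h1.congr_of_eventuallyEq ?_
    have hc : Tendsto (fun t : ℝ => x + t • (Pi.single i 1 : Fin n → ℝ)) (𝓝 0) (𝓝 x) := by
      have := hline.continuousAt.tendsto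
      rwa [h0] at this
    filter_upwards [hc.eventually hfg] with t ht
    rw [hupd, ht]
    rfl
  have hex : ∃ v : Cl n, ∀ φ : Cl n →ₗ[ℝ] ℝ,
      HasDerivAt (fun t : ℝ => φ (f (Function.update x i (x i + t)))) (φ v) 0 := ⟨_, key⟩
  unfold clPDeriv
  rw [dif_pos hex]
  exact cl_dual_ext fun φ => (hex.choose_spec φ).unique (key φ)

/-- the linear symbol of the Dirac operator -/
def dirL (n : ℕ) : ((Fin n → ℝ) →L[ℝ] (Fin n → ℝ)) →ₗ[ℝ] Cl n where
  toFun A := ∑ i : Fin n, eCl i * clL n (A (Pi.single i 1))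
  map_add' A B := by simp [mul_add, Finset.sum_add_distrib]
  map_smul' c A := by simp [Finset.smul_sum]

def dirF {n : ℕ} (φ : Cl n →ₗ[ℝ] ℝ) : ((Fin n → ℝ) →L[ℝ] (Fin n → ℝ)) →L[ℝ] ℝ :=
  LinearMap.toContinuousLinearMap (φ ∘ₗ dirL n)

lemma dirF_apply {n : ℕ} (φ : Cl n →ₗ[ℝ] ℝ) (A) : dirF φ A = φ (dirL n A) := rfl

lemma Dirac_eq {n : ℕ} {f : (Fin n → ℝ) → Cl n} {g : (Fin n → ℝ) → (Fin n → ℝ)}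
    {g' : (Fin n → ℝ) →L[ℝ] (Fin n → ℝ)} {x : Fin n → ℝ}
    (hfg : ∀ᶠ y in 𝓝 x, f y = clVec (g y)) (hg : HasFDerivAt g g' x) :
    Dirac f x = dirL n g' := by
  unfold Dirac
  simp only [clPDeriv_eq hfg hg]
  rfl

structure Good {n : ℕ} (k : ℕ) (f : (Fin n → ℝ) → Cl n)
    (g : (Fin n → ℝ) → (Fin n → ℝ)) : Prop where
  smooth : ∀ x, x ≠ 0 → ContDiffAt ℝ ∞ g x
  hom : ∀ t : ℝ, 0 < t → ∀ x, x ≠ 0 → g (t • x) = (t ^ k)⁻¹ • g x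
  mono : ∀ x, x ≠ 0 → dirL n (fderiv ℝ g x) = 0
  eq : ∀ x, x ≠ 0 → f x = clVec (g x)

lemma Good.fderiv_hom {n k : ℕ} {f : (Fin n → ℝ) → Cl n}
    {g : (Fin n → ℝ) → (Fin n → ℝ)} (h : Good k f g) (t : ℝ) (ht : 0 < t)
    (x : Fin n → ℝ) (hx : x ≠ 0) :
    fderiv ℝ g (t • x) = (t ^ (k + 1))⁻¹ • fderiv ℝ g x := by
  have htx : t • x ≠ 0 := smul_ne_zero ht.ne' hx
  have h1 : HasFDerivAt (fun y : Fin n → ℝ => g (t • y)) (t • fderiv ℝ g (t • x)) x := by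
    have a := ((h.smooth _ htx).differentiableAt (by simp)).hasFDerivAt
    have b : HasFDerivAt (fun y : Fin n → ℝ => t • y) (t • ContinuousLinearMap.id ℝ _) x :=
      (hasFDerivAt_id x).const_smul t
    refine HasFDerivAt.congr_fderiv (a.comp x b) ?_
    ext v
    simp
  have h2 : HasFDerivAt (fun y : Fin n → ℝ => g (t • y)) ((t ^ k)⁻¹ • fderiv ℝ g x) x := by
    have a := ((h.smooth _ hx).differentiableAt (by simp)).hasFDerivAt
    refine (a.const_smul ((t ^ k)⁻¹)).congr_of_eventuallyEq ?_
    filter_upwards [isOpen_ne.mem_nhds hx] with y hy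
    exact h.hom t ht y hy
  have h3 := h1.unique h2
  have h4 : fderiv ℝ g (t • x) = t⁻¹ • (t • fderiv ℝ g (t • x)) := by
    rw [smul_smul, inv_mul_cancel₀ ht.ne', one_smul]
  rw [h4, h3, smul_smul]
  congr 1
  rw [pow_succ, mul_inv, mul_comm]

lemma Good.step {n k : ℕ} {f : (Fin n → ℝ) → Cl n}
    {g : (Fin n → ℝ) → (Fin n → ℝ)} (h : Good k f g) (i : Fin n) :
    Good (k + 1) (clPDeriv i f) (fun x => fderiv ℝ g x (Pi.single i 1)) := by
  have hsm : ∀ x, x ≠ 0 → ContDiffAt ℝ ∞ (fderiv ℝ g) x := fun x hx =>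
    (h.smooth x hx).fderiv_right (by simp)
  refine ⟨?_, ?_, ?_, ?_⟩
  · intro x hx
    exact (hsm x hx).clm_apply contDiffAt_const
  · intro t ht x hx
    simp only [h.fderiv_hom t ht x hx]
    rfl
  · intro x hx
    have hd := ((hsm x hx).differentiableAt (by simp)).hasFDerivAt
    have hsymm : IsSymmSndFDerivAt ℝ g x := (h.smooth x hx).isSymmSndFDerivAt (by
      simp only [minSmoothness_of_isRCLikeNormedField]
      exact WithTop.coe_le_coe.2 (le_top : (2 : ℕ∞) ≤ ⊤))
    have h1 : fderiv ℝ (fun x => fderiv ℝ g x (Pi.single i 1)) x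
        = fderiv ℝ (fderiv ℝ g) x (Pi.single i 1) := by
      have := (hd.clm_apply (hasFDerivAt_const (Pi.single i 1 : Fin n → ℝ) x)).fderiv
      rw [this]
      ext v j
      simp [hsymm.eq v (Pi.single i 1)]
    rw [h1]
    apply cl_dual_ext
    intro φ
    have h2 : HasFDerivAt (fun y => dirF φ (fderiv ℝ g y))
        ((dirF φ).comp (fderiv ℝ (fderiv ℝ g) x)) x := (dirF φ).hasFDerivAt.comp x hd
    have h3 : HasFDerivAt (fun y => dirF φ (fderiv ℝ g y)) (0 : (Fin n → ℝ) →L[ℝ] ℝ) x := by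
      refine (hasFDerivAt_const (0 : ℝ) x).congr_of_eventuallyEq ?_
      filter_upwards [isOpen_ne.mem_nhds hx] with y hy
      rw [dirF_apply, h.mono y hy, map_zero]
    have h4 := congrArg (fun A : (Fin n → ℝ) →L[ℝ] ℝ => A (Pi.single i 1)) (h2.unique h3)
    exact h4.trans (φ.map_zero).symm
  · intro x hx
    apply clPDeriv_eq
    · filter_upwards [isOpen_ne.mem_nhds hx] with y hy
      exact h.eq y hy
    · exact ((h.smooth _ hx).differentiableAt (by simp)).hasFDerivAt

lemma Good.iter {n k : ℕ} {f : (Fin n → ℝ) → Cl n} (h : ∃ g, Good k f g) (i : Fin n) (l : ℕ) :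
    ∃ g, Good (k + l) (clPDerivIter i l f) g := by
  induction l with
  | zero => exact h
  | succ l ih =>
    obtain ⟨g, hg⟩ := ih
    exact ⟨_, hg.step i⟩

lemma Good.multi {n k : ℕ} {f : (Fin n → ℝ) → Cl n} (h : ∃ g, Good k f g) (m : Fin n → ℕ) :
    ∃ g, Good (k + ∑ i, m i) (multiPDeriv m f) g := by
  have key : ∀ L : List (Fin n), ∃ g, Good (k + (L.map m).sum)
      (L.foldr (fun i g => clPDerivIter i (m i) g) f) g := by
    intro L
    induction L with
    | nil => simpa using h
    | cons a L ih =>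
      have := Good.iter ih a (m a)
      rw [List.map_cons, List.sum_cons, List.foldr_cons, add_comm (m a), ← add_assoc]
      exact this
  have := key (List.finRange n)
  have hs : ((List.finRange n).map m).sum = ∑ i, m i := by
    rw [← List.ofFn_eq_map, List.sum_ofFn]
  rw [hs] at this
  exact this

lemma Good.base {n : ℕ} (hn : 2 ≤ n) :
    Good (n - 1) (qfun 1 : (Fin n → ℝ) → Cl n)
      (fun x => ((Real.sqrt (∑ i, x i ^ 2)) ^ n)⁻¹ • x) := by
  have hpos : ∀ x : Fin n → ℝ, x ≠ 0 → 0 < ∑ i, x i ^ 2 := by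
    intro x hx
    obtain ⟨j, hj⟩ := Function.ne_iff.1 hx
    exact Finset.sum_pos' (fun i _ => sq_nonneg _)
      ⟨j, Finset.mem_univ _, by have : x j ≠ 0 := hj
                                positivity⟩
  refine ⟨?_, ?_, ?_, ?_⟩
  · intro x hx
    have hp := hpos x hx
    have h1 : ContDiffAt ℝ ∞ (fun x : Fin n → ℝ => ∑ i, x i ^ 2) x := by fun_prop
    have h2 := ((h1.sqrt hp.ne').pow n).inv (by positivity)
    exact h2.smul contDiffAt_id
  · intro t ht x hx
    have h1 : ∑ i, (t • x) i ^ 2 = t ^ 2 * ∑ i, x i ^ 2 := by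
      simp [mul_pow, Finset.mul_sum]
    have hp := hpos x hx
    simp only [h1]
    rw [Real.sqrt_mul (by positivity), Real.sqrt_sq ht.le, smul_smul, smul_smul]
    congr 1
    obtain ⟨k, rfl⟩ : ∃ k, n = k + 1 := ⟨n - 1, by omega⟩
    simp only [Nat.add_sub_cancel]
    rw [mul_pow, pow_succ t k]
    field_simp
  · intro x hx
    have hp := hpos x hx
    set S := ∑ i, x i ^ 2 with hS
    have hd1 : HasFDerivAt (fun x : Fin n → ℝ => ∑ i, x i ^ 2)
        (∑ i, (2 * x i) • (ContinuousLinearMap.proj i : (Fin n → ℝ) →L[ℝ] ℝ)) x := by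
      apply HasFDerivAt.fun_sum
      intro i _
      have := (hasFDerivAt_apply (𝕜 := ℝ) i x).pow 2
      simpa using this
    have hr : 0 < Real.sqrt S := Real.sqrt_pos.2 hp
    have hψ : HasDerivAt (fun s : ℝ => (Real.sqrt s ^ n)⁻¹)
        (-(n / 2) * ((Real.sqrt S ^ n)⁻¹ / S)) S := by
      have hss : S = Real.sqrt S ^ 2 := (Real.sq_sqrt hp.le).symm
      have a := ((Real.hasDerivAt_sqrt hp.ne').fun_pow n).fun_inv (pow_pos hr n).ne'
      refine a.congr_deriv ?_
      obtain ⟨k, rfl⟩ : ∃ k, n = k + 1 := ⟨n - 1, by omega⟩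
      simp only [Nat.add_sub_cancel]
      rw [eq_comm]
      have e : ((Real.sqrt S ^ (k + 1))⁻¹ / S) = ((Real.sqrt S ^ (k + 1))⁻¹ / Real.sqrt S ^ 2) := by
        rw [← hss]
      rw [e]
      field_simp
      ring
    have hd2 := hψ.comp_hasFDerivAt x hd1
    have hd3 := hd2.smul (hasFDerivAt_id x)
    set ρ := (Real.sqrt S ^ n)⁻¹ with hρ
    have hfd : HasFDerivAt (fun x : Fin n → ℝ => ((Real.sqrt (∑ i, x i ^ 2)) ^ n)⁻¹ • x)
      (ρ • ContinuousLinearMap.id ℝ (Fin n → ℝ) + ((-(n / 2) * (ρ / S)) • ∑ j, (2 * x j) •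
        (ContinuousLinearMap.proj j : (Fin n → ℝ) →L[ℝ] ℝ)).smulRight x) x := hd3
    rw [hfd.fderiv]
    set A := (ρ • ContinuousLinearMap.id ℝ (Fin n → ℝ) + ((-(n / 2) * (ρ / S)) • ∑ j, (2 * x j) •
        (ContinuousLinearMap.proj j : (Fin n → ℝ) →L[ℝ] ℝ)).smulRight x) with hA
    have hdir : ∀ i : Fin n, (∑ j, (2 * x j) • (ContinuousLinearMap.proj j : (Fin n → ℝ) →L[ℝ] ℝ))
        (Pi.single i 1) = 2 * x i := by
      intro i
      simp [Pi.single_apply]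
    have hsum : ∑ i, x i • eCl i = clVec x := by
      have : x = ∑ i, x i • (Pi.single i 1 : Fin n → ℝ) := by
        ext j; simp [Pi.single_apply]
      conv_rhs => rw [this, ← clL_apply, map_sum]
      simp only [map_smul]
      rfl
    have he : ∀ i : Fin n, eCl i * eCl i = (-1 : Cl n) := by
      intro i
      unfold eCl
      rw [clVec_mul_self]
      simp [Pi.single_apply]
    have hterm : ∀ i : Fin n, eCl i * clL n (A (Pi.single i 1))
        = ρ • (-1 : Cl n) - (n * ρ / S) • ((x i • eCl i) * clVec x) := by
      intro i
      have : A (Pi.single i 1) = ρ • (Pi.single i 1 : Fin n → ℝ) +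
          ((-(n / 2) * (ρ / S)) * (2 * x i)) • x := by
        rw [← hdir i]; rfl
      rw [this, map_add, map_smul, map_smul, mul_add, mul_smul_comm, mul_smul_comm, clL_apply,
        clL_apply, show clVec (Pi.single i 1) = eCl i from rfl, he, smul_mul_assoc, smul_smul,
        sub_eq_add_neg, ← neg_smul]
      congr 2
      field_simp
    have hD : dirL n A = ∑ i : Fin n, eCl i * clL n (A (Pi.single i 1)) := rfl
    rw [hD, Finset.sum_congr rfl fun i _ => hterm i]
    rw [Finset.sum_sub_distrib, Finset.sum_const, ← Finset.smul_sum, ← Finset.sum_mul, hsum, clVec_mul_self,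
      ← hS, Algebra.algebraMap_eq_smul_one, smul_smul]
    have hc : (n * ρ / S) * -S = - (n * ρ) := by field_simp
    rw [hc]
    simp only [Finset.card_univ, Fintype.card_fin]
    rw [← Nat.cast_smul_eq_nsmul ℝ, smul_smul, smul_neg, neg_smul, sub_neg_eq_add, neg_add_cancel]
  · intro x hx
    simp only [qfun, qker, clNorm_clVec, odd_one, if_true, Nat.add_sub_cancel]
    rw [← clL_apply, ← clL_apply, map_smul]

end smoothpart

lemma decay {n : ℕ} {V : Type*} [NormedAddCommGroup V] [NormedSpace ℝ V] {k : ℕ}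
    {h : (Fin n → ℝ) → V} (hc : ∀ x, x ≠ 0 → ContinuousAt h x)
    (hh : ∀ t : ℝ, 0 < t → ∀ x, x ≠ 0 → h (t • x) = (t ^ k)⁻¹ • h x) :
    ∃ C : ℝ, 0 ≤ C ∧ ∀ x, x ≠ 0 → ‖h x‖ ≤ C * (‖x‖ ^ k)⁻¹ := by
  have hcomp : IsCompact (Metric.sphere (0 : Fin n → ℝ) 1) := isCompact_sphere _ _
  obtain ⟨C, hC⟩ := hcomp.exists_bound_of_continuousOn (f := h) (by
    intro x hx
    refine (hc x ?_).continuousWithinAt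
    rintro rfl
    simp at hx)
  refine ⟨max C 0, le_max_right _ _, ?_⟩
  intro x hx
  have hn : 0 < ‖x‖ := norm_pos_iff.2 hx
  have hu : ‖x‖⁻¹ • x ≠ 0 := smul_ne_zero (inv_pos.2 hn).ne' hx
  have h1 : h x = (‖x‖ ^ k)⁻¹ • h (‖x‖⁻¹ • x) := by
    rw [← hh ‖x‖ hn _ hu, smul_smul, mul_inv_cancel₀ hn.ne', one_smul]
  have h2 : ‖h (‖x‖⁻¹ • x)‖ ≤ C := hC _ (by
    simp [norm_smul, inv_mul_cancel₀ hn.ne'])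
  rw [h1, norm_smul, norm_inv, norm_pow, norm_norm, mul_comm]
  gcongr
  exact h2.trans (le_max_left _ _)

/-- the integer vector associated with an index -/
def latt {n : ℕ} (v : GmIdx n) : Fin n → ℤ := fun j => if (j : ℕ) = n - 1 then v.1.1 else v.1.2 j

lemma latt_inj {n : ℕ} (hn : 2 ≤ n) : Function.Injective (latt (n := n)) := by
  rintro ⟨⟨α, ω⟩, h1, h2⟩ ⟨⟨β, η⟩, h3, h4⟩ h
  have ha : α = β := by
    have := congrFun h ⟨n - 1, by omega⟩
    simpa [latt] using this
  have hb : ω = η := by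
    ext j
    by_cases hj : (j : ℕ) = n - 1
    · exact (h1 j hj).trans (h3 j hj).symm
    · have := congrFun h j
      simpa [latt, hj] using this
  subst ha hb
  rfl

lemma latVec_inj {n : ℕ} : Function.Injective (latVec (n := n)) := by
  intro a b h
  ext j
  have := congrFun h j
  simpa [latVec] using this

lemma latt_pos {n : ℕ} (hn : 2 ≤ n) (v : GmIdx n) : 0 < ‖latVec (latt v)‖ := by
  rw [norm_pos_iff]
  intro h
  have h0 : latt v = 0 := by
    apply latVec_inj
    rw [h]; ext j; simp [latVec]
  obtain ⟨⟨α, ω⟩, h1, h2⟩ := v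
  apply h2
  have ha : α = 0 := by
    have := congrFun h0 ⟨n - 1, by omega⟩
    simpa [latt] using this
  have hb : ω = 0 := by
    ext j
    by_cases hj : (j : ℕ) = n - 1
    · exact h1 j hj
    · have := congrFun h0 j
      simpa [latt, hj] using this
  rw [ha, hb]; rfl

lemma alpha_le {n : ℕ} (hn : 2 ≤ n) (v : GmIdx n) : |(v.1.1 : ℝ)| ≤ ‖latVec (latt v)‖ := by
  have := norm_le_pi_norm (latVec (latt v)) ⟨n - 1, by omega⟩
  simpa [latVec, latt] using this

lemma summable_latt {n : ℕ} (hn : 2 ≤ n) {k : ℕ} (hk : n < k) :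
    Summable fun v : GmIdx n => (‖latVec (latt v)‖ ^ k)⁻¹ := by
  let L : Submodule ℤ (Fin n → ℝ) := Submodule.span ℤ (Set.range (Pi.basisFun ℝ (Fin n)))
  have hr : Module.finrank ℤ L = n := by
    rw [ZLattice.rank ℝ L]; simp
  have hs := ZLattice.summable_norm_pow_inv L k (by omega)
  have hmem : ∀ w : Fin n → ℤ, latVec w ∈ L := by
    intro w
    have : latVec w = ∑ i, w i • (Pi.basisFun ℝ (Fin n)) i := by
      ext j
      simp [latVec, Pi.single_apply]
    rw [this]
    exact Submodule.sum_mem _ fun i _ => Submodule.smul_mem _ _ (Submodule.subset_span ⟨i, rfl⟩)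
  let e : GmIdx n → L := fun v => ⟨latVec (latt v), hmem _⟩
  have he : Function.Injective e := by
    intro a b h
    exact latt_inj hn (latVec_inj (congrArg Subtype.val h))
  have := hs.comp_injective he
  refine this.congr fun v => ?_
  simp only [Function.comp, inv_pow]
  rfl

def Reg (n : ℕ) (R δ : ℝ) : Set (Fin n → ℝ) :=
  {x | (∀ j : Fin n, (j : ℕ) ≠ n - 1 → |x j| ≤ R) ∧ δ ≤ lastc n x}

lemma lastc_eq {n : ℕ} (hn : 2 ≤ n) (x : Fin n → ℝ) :
    lastc n x = x ⟨n - 1, by omega⟩ := by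
  unfold lastc
  rw [dif_pos (by omega)]

lemma low {n : ℕ} (hn : 2 ≤ n) {R δ : ℝ} (hR : 0 ≤ R) (hδ : 0 < δ) {x : Fin n → ℝ}
    (hx : x ∈ Reg n R δ) (v : GmIdx n) :
    ‖latVec (latt v)‖ ≤ (1 + (R + 1) / δ) * ‖(v.1.1 : ℝ) • x + latVec v.1.2‖ := by
  obtain ⟨hx1, hx2⟩ := hx
  rw [lastc_eq hn] at hx2
  obtain ⟨⟨α, ω⟩, h1, h2⟩ := v
  simp only
  set y := (α : ℝ) • x + latVec ω with hy
  have ha : |(α : ℝ)| * δ ≤ ‖y‖ := by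
    refine le_trans ?_ (norm_le_pi_norm y ⟨n - 1, by omega⟩)
    have : y ⟨n - 1, by omega⟩ = α * x ⟨n - 1, by omega⟩ := by
      have h0 : ω ⟨n - 1, by omega⟩ = 0 := h1 ⟨n - 1, by omega⟩ rfl
      simp [hy, latVec, h0]
    rw [this, Real.norm_eq_abs, abs_mul]
    gcongr
    exact hx2.trans (le_abs_self _)
  have ha' : |(α : ℝ)| ≤ ‖y‖ / δ := by rwa [le_div_iff₀ hδ]
  have hexp : (1 + (R + 1) / δ) * ‖y‖ = ‖y‖ + R * (‖y‖ / δ) + ‖y‖ / δ := by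
    field_simp
    ring
  rw [hexp]
  have hyd : 0 ≤ ‖y‖ / δ := by positivity
  refine (pi_norm_le_iff_of_nonneg (by positivity)).2 ?_
  intro j
  by_cases hj : (j : ℕ) = n - 1
  · have : latVec (latt ⟨(α, ω), h1, h2⟩) j = α := by simp [latVec, latt, hj]
    rw [this, Real.norm_eq_abs]
    have : 0 ≤ ‖y‖ + R * (‖y‖ / δ) := by positivity
    linarith
  · have : latVec (latt ⟨(α, ω), h1, h2⟩) j = y j - α * x j := by
      simp [latVec, latt, hj, hy]
    rw [this]
    have h3 : ‖y j - α * x j‖ ≤ ‖y j‖ + |(α : ℝ)| * |x j| := by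
      refine (norm_sub_le _ _).trans ?_
      rw [norm_mul]; rfl
    have h4 := norm_le_pi_norm y j
    have h5 : |(α : ℝ)| * |x j| ≤ (‖y‖ / δ) * R := by
      gcongr
      exact hx1 j hj
    linarith

lemma reg_bound {n : ℕ} (hn : 2 ≤ n) {V : Type*} [NormedAddCommGroup V] [NormedSpace ℝ V] {k : ℕ}
    {h : (Fin n → ℝ) → V} (hc : ∀ x, x ≠ 0 → ContinuousAt h x)
    (hh : ∀ t : ℝ, 0 < t → ∀ x, x ≠ 0 → h (t • x) = (t ^ k)⁻¹ • h x)
    {R δ : ℝ} (hR : 0 ≤ R) (hδ : 0 < δ) :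
    ∃ C : ℝ, 0 ≤ C ∧ ∀ v : GmIdx n, ∀ x ∈ Reg n R δ,
      ‖h ((v.1.1 : ℝ) • x + latVec v.1.2)‖ ≤ C * (‖latVec (latt v)‖ ^ k)⁻¹ := by
  obtain ⟨C, hC, hb⟩ := decay hc hh
  have hcp : 0 < 1 + (R + 1) / δ := by positivity
  refine ⟨C * (1 + (R + 1) / δ) ^ k, by positivity, ?_⟩
  intro v x hx
  have hl := low hn hR hδ hx v
  have hp := latt_pos hn v
  set c := 1 + (R + 1) / δ
  set y := (v.1.1 : ℝ) • x + latVec v.1.2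
  have hy : 0 < ‖y‖ := by
    by_contra hneg
    have : ‖y‖ ≤ 0 := not_lt.1 hneg
    nlinarith
  refine (hb y (norm_pos_iff.1 hy)).trans ?_
  rw [mul_assoc]
  gcongr
  rw [← div_eq_mul_inv, le_div_iff₀ (by positivity), inv_mul_le_iff₀ (by positivity), ← mul_pow]
  rw [mul_comm ‖y‖]
  gcongr

lemma ne_zero_of_upH {n : ℕ} (hn : 2 ≤ n) {x : Fin n → ℝ} (hx : x ∈ upH n) (v : GmIdx n) :
    (v.1.1 : ℝ) • x + latVec v.1.2 ≠ 0 := by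
  have hx' : 0 < lastc n x := hx
  have := low hn (norm_nonneg x) hx' (x := x) ⟨fun j _ => norm_le_pi_norm x j, le_rfl⟩ v
  intro h0
  rw [h0, norm_zero, mul_zero] at this
  exact absurd (latt_pos hn v) (not_lt.2 this)

lemma upH_of_reg {n : ℕ} {R δ : ℝ} (hδ : 0 < δ) {x : Fin n → ℝ} (hx : x ∈ Reg n R δ) :
    x ∈ upH n := lt_of_lt_of_le hδ hx.2

lemma mem_reg_self {n : ℕ} (x : Fin n → ℝ) : x ∈ Reg n ‖x‖ (lastc n x) :=
  ⟨fun j _ => norm_le_pi_norm x j, le_rfl⟩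

section series
variable {n k : ℕ} {f : (Fin n → ℝ) → Cl n} {g : (Fin n → ℝ) → (Fin n → ℝ)}

lemma Good.bound (hg : Good k f g) (hn : 2 ≤ n) (hk : n < k) {R δ : ℝ} (hR : 0 ≤ R)
    (hδ : 0 < δ) : ∃ b : GmIdx n → ℝ, Summable b ∧ ∀ v : GmIdx n, ∀ x ∈ Reg n R δ,
      ‖g ((v.1.1 : ℝ) • x + latVec v.1.2)‖ ≤ b v := by
  obtain ⟨C, hC, hb⟩ := reg_bound hn (fun x hx => (hg.smooth x hx).continuousAt) hg.hom hR hδ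
  exact ⟨_, (summable_latt hn hk).mul_left C, hb⟩

lemma Good.bound' (hg : Good k f g) (hn : 2 ≤ n) (hk : n < k) {R δ : ℝ} (hR : 0 ≤ R)
    (hδ : 0 < δ) : ∃ b : GmIdx n → ℝ, Summable b ∧ ∀ v : GmIdx n, ∀ x ∈ Reg n R δ,
      ‖(v.1.1 : ℝ) • fderiv ℝ g ((v.1.1 : ℝ) • x + latVec v.1.2)‖ ≤ b v := by
  obtain ⟨C, hC, hb⟩ := reg_bound hn (h := fderiv ℝ g) (k := k + 1)
    (fun x hx => ((hg.smooth x hx).fderiv_right (m := ((⊤ : ℕ∞) : WithTop ℕ∞)) (by simp)).continuousAt)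
    hg.fderiv_hom hR hδ
  refine ⟨_, (summable_latt hn hk).mul_left C, fun v x hx => ?_⟩
  have hp := latt_pos hn v
  rw [norm_smul]
  calc ‖(v.1.1 : ℝ)‖ * ‖fderiv ℝ g ((v.1.1 : ℝ) • x + latVec v.1.2)‖
      ≤ ‖latVec (latt v)‖ * (C * (‖latVec (latt v)‖ ^ (k + 1))⁻¹) := by
        gcongr
        · exact alpha_le hn v
        · exact hb v x hx
    _ = C * (‖latVec (latt v)‖ ^ k)⁻¹ := by
        rw [pow_succ]; field_simp

lemma Good.summable (hg : Good k f g) (hn : 2 ≤ n) (hk : n < k) {x : Fin n → ℝ}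
    (hx : x ∈ upH n) :
    Summable fun v : GmIdx n => g ((v.1.1 : ℝ) • x + latVec v.1.2) := by
  obtain ⟨b, hb, hb'⟩ := hg.bound hn hk (norm_nonneg x) hx
  exact Summable.of_norm_bounded hb fun v => hb' v x (mem_reg_self x)

lemma Good.hasFDerivAt (hg : Good k f g) (hn : 2 ≤ n) (hk : n < k) {x : Fin n → ℝ}
    (hx : x ∈ upH n) :
    ∃ A : GmIdx n → ((Fin n → ℝ) →L[ℝ] (Fin n → ℝ)), Summable A ∧ (∀ v, dirL n (A v) = 0) ∧
    HasFDerivAt (fun y => ∑' v : GmIdx n, g ((v.1.1 : ℝ) • y + latVec v.1.2)) (∑' v, A v) x := by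
  have hx' : 0 < lastc n x := hx
  set ε := lastc n x / 2 with hε
  have hεp : 0 < ε := by positivity
  have hball : ∀ y ∈ Metric.ball x ε, y ∈ Reg n (‖x‖ + ε) ε := by
    intro y hy
    have hd : ∀ j, |y j - x j| < ε := by
      intro j
      rw [mem_ball_iff_norm] at hy
      exact (norm_le_pi_norm (y - x) j).trans_lt hy
    constructor
    · intro j _
      have h1 := norm_le_pi_norm x j
      rw [Real.norm_eq_abs] at h1
      have h2 := abs_add_le (x j) (y j - x j)
      rw [add_sub_cancel] at h2
      linarith [hd j]
    · rw [lastc_eq hn] at hε ⊢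
      have := (abs_lt.1 (hd ⟨n - 1, by omega⟩)).1
      linarith
  obtain ⟨b, hb, hb'⟩ := hg.bound' hn hk (R := ‖x‖ + ε) (by positivity) hεp
  have hxb : x ∈ Metric.ball x ε := Metric.mem_ball_self hεp
  refine ⟨fun v => (v.1.1 : ℝ) • fderiv ℝ g ((v.1.1 : ℝ) • x + latVec v.1.2), ?_, ?_, ?_⟩
  · exact Summable.of_norm_bounded hb fun v => hb' v x (hball x hxb)
  · intro v
    rw [map_smul, hg.mono _ (ne_zero_of_upH hn hx v), smul_zero]
  · have hder : ∀ (v : GmIdx n) (y : Fin n → ℝ), y ∈ Metric.ball x ε →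
        HasFDerivAt (fun y : Fin n → ℝ => g ((v.1.1 : ℝ) • y + latVec v.1.2))
          ((v.1.1 : ℝ) • fderiv ℝ g ((v.1.1 : ℝ) • y + latVec v.1.2)) y := by
      intro v y hy
      have hne := ne_zero_of_upH hn (upH_of_reg hεp (hball y hy)) v
      have a := ((hg.smooth _ hne).differentiableAt (by simp)).hasFDerivAt
      have c : HasFDerivAt (fun y : Fin n → ℝ => (v.1.1 : ℝ) • y + latVec v.1.2)
          ((v.1.1 : ℝ) • ContinuousLinearMap.id ℝ _) y :=
        ((hasFDerivAt_id y).const_smul (v.1.1 : ℝ)).add_const (latVec v.1.2)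
      refine HasFDerivAt.congr_fderiv (HasFDerivAt.comp y a c) ?_
      ext w
      simp
    have hbd : ∀ (v : GmIdx n) (y : Fin n → ℝ), y ∈ Metric.ball x ε →
        ‖(v.1.1 : ℝ) • fderiv ℝ g ((v.1.1 : ℝ) • y + latVec v.1.2)‖ ≤ b v :=
      fun v y hy => hb' v y (hball y hy)
    have hs0 := hg.summable hn hk hx
    exact hasFDerivAt_tsum_of_isPreconnected
      (f := fun (v : GmIdx n) (y : Fin n → ℝ) => g ((v.1.1 : ℝ) • y + latVec v.1.2))
      (f' := fun (v : GmIdx n) (y : Fin n → ℝ) =>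
        (v.1.1 : ℝ) • fderiv ℝ g ((v.1.1 : ℝ) • y + latVec v.1.2))
      hb Metric.isOpen_ball (convex_ball x ε).isPreconnected hder hbd hxb hs0 hxb

end series

lemma isOpen_upH {n : ℕ} (hn : 2 ≤ n) : IsOpen (upH n) := by
  have : upH n = {x | 0 < x ⟨n - 1, by omega⟩} := by
    ext x; unfold upH; simp only [Set.mem_ofPred_eq, lastc_eq hn]
  rw [this]
  exact isOpen_lt continuous_const (continuous_apply _)

/-- the shear `(α, η) ↦ (α, η + αω)` on the index set -/
def shear {n : ℕ} (ω : Fin n → ℤ) (hω : horPart n ω) (v : GmIdx n) : GmIdx n :=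
  ⟨(v.1.1, v.1.2 + v.1.1 • ω), by
    intro j hj
    simp [v.2.1 j hj, hω j hj], by
    intro h
    apply v.2.2
    have h1 : v.1.1 = 0 := congrArg Prod.fst h
    have h2 : v.1.2 + v.1.1 • ω = 0 := congrArg Prod.snd h
    rw [h1, zero_smul, add_zero] at h2
    exact Prod.ext h1 h2⟩

def shearEquiv {n : ℕ} (ω : Fin n → ℤ) (hω : horPart n ω) : GmIdx n ≃ GmIdx n where
  toFun := shear ω hω
  invFun := shear (-ω) (fun j hj => by simp [hω j hj])
  left_inv v := by
    apply Subtype.ext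
    simp [shear]
  right_inv v := by
    apply Subtype.ext
    simp [shear]

lemma Gterm_shear {n : ℕ} (m : Fin n → ℕ) (ω : Fin n → ℤ) (hω : horPart n ω) (x : Fin n → ℝ)
    (v : GmIdx n) : Gterm m (x + latVec ω) v = Gterm m x (shearEquiv ω hω v) := by
  unfold Gterm
  congr 1
  change (v.1.1 : ℝ) • (x + latVec ω) + latVec v.1.2
    = (v.1.1 : ℝ) • x + latVec (v.1.2 + v.1.1 • ω)
  ext j
  simp [latVec]
  ring

lemma Gm_shift {n : ℕ} (m : Fin n → ℕ) (ω : Fin n → ℤ) (hω : horPart n ω) (x : Fin n → ℝ)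
    (a : Cl n) (h : HasClSum (Gterm m x) a) : Gm m (x + latVec ω) = Gm m x := by
  rw [Gm_eq h]
  apply Gm_eq
  intro φ
  have := (shearEquiv ω hω).hasSum_iff.2 (h φ)
  convert this using 2 with v
  exact congrArg φ (Gterm_shear m ω hω x v)

/-- normal convergence, monogenicity, periodicity and boundedness of the
monogenic Eisenstein series `G_m` for odd `|m| ≥ 3`. -/
theorem stmt18 (n : ℕ) (hn : 2 ≤ n) (m : Fin n → ℕ)
    (hm3 : 3 ≤ ∑ i, m i) (hmo : Odd (∑ i, m i)) :
    (∀ x ∈ upH n, HasClSum (Gterm m x) (Gm m x)) ∧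
    (∀ K : Set (Fin n → ℝ), K ⊆ upH n → IsCompact K →
      ∃ b : GmIdx n → ℝ, Summable b ∧ ∀ v : GmIdx n, ∀ x ∈ K, clNorm (Gterm m x v) ≤ b v) ∧
    (∀ x ∈ upH n, Dirac (Gm m) x = 0) ∧
    (∀ ω : Fin n → ℤ, horPart n ω → ∀ x ∈ upH n, Gm m (x + latVec ω) = Gm m x) ∧
    (∃ C : ℝ, ∀ x : Fin n → ℝ, 1 ≤ lastc n x → clNorm (Gm m x) ≤ C) := by
  obtain ⟨g, hg⟩ := Good.multi ⟨_, Good.base hn⟩ m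
  have hk : n < n - 1 + ∑ i, m i := by omega
  have hterm : ∀ x ∈ upH n, ∀ v, Gterm m x v = clVec (g ((v.1.1 : ℝ) • x + latVec v.1.2)) :=
    fun x hx v => hg.eq _ (ne_zero_of_upH hn hx v)
  have hsum : ∀ x ∈ upH n, HasClSum (Gterm m x)
      (clVec (∑' v : GmIdx n, g ((v.1.1 : ℝ) • x + latVec v.1.2))) := by
    intro x hx
    have := hasClSum_clVec (hg.summable hn hk hx).hasSum
    rwa [show Gterm m x = _ from funext (hterm x hx)]
  have hshift : ∀ ω : Fin n → ℤ, horPart n ω → ∀ x ∈ upH n, Gm m (x + latVec ω) = Gm m x :=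
    fun ω hω x hx => Gm_shift m ω hω x _ (hsum x hx)
  refine ⟨?_, ?_, ?_, hshift, ?_⟩
  · intro x hx
    rw [Gm_eq (hsum x hx)]
    exact hsum x hx
  · intro K hK hKc
    rcases K.eq_empty_or_nonempty with rfl | hne
    · exact ⟨0, summable_zero, fun v x hx => absurd hx (Set.notMem_empty x)⟩
    obtain ⟨R, hR⟩ := hKc.isBounded.exists_norm_le
    have hcont : Continuous (lastc n) := by
      have : lastc n = fun x => x ⟨n - 1, by omega⟩ := funext fun x => lastc_eq hn x
      rw [this]; exact continuous_apply _
    obtain ⟨x₀, hx₀, hmin⟩ := hKc.exists_isMinOn hne hcont.continuousOn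
    have hδ : 0 < lastc n x₀ := hK hx₀
    obtain ⟨b, hb, hb'⟩ := hg.bound hn hk (R := max R 0) (le_max_right _ _) hδ
    refine ⟨fun v => n * b v, hb.mul_left _, ?_⟩
    intro v x hx
    rw [hterm x (hK hx) v]
    refine (clNorm_clVec_le _).trans ?_
    refine mul_le_mul_of_nonneg_left ?_ (Nat.cast_nonneg _)
    apply hb'
    exact ⟨fun j _ => (norm_le_pi_norm x j).trans ((hR x hx).trans (le_max_left _ _)), hmin hx⟩
  · intro x hx
    obtain ⟨A, hA, hA0, hd⟩ := hg.hasFDerivAt hn hk hx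
    rw [Dirac_eq (f := Gm m) ?_ hd]
    · apply cl_dual_ext
      intro φ
      rw [← dirF_apply, (dirF φ).map_tsum hA, map_zero]
      simp [dirF_apply, hA0]
    · filter_upwards [(isOpen_upH hn).mem_nhds hx] with y hy
      exact Gm_eq (hsum y hy)
  · obtain ⟨b, hb, hb'⟩ := hg.bound hn hk (R := 1) zero_le_one zero_lt_one
    refine ⟨n * ∑' v, b v, ?_⟩
    intro x hx
    have hxu : x ∈ upH n := lt_of_lt_of_le zero_lt_one hx
    let ω : Fin n → ℤ := fun j => if (j : ℕ) = n - 1 then 0 else -⌊x j⌋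
    have hω : horPart n ω := fun j hj => by simp [ω, hj]
    rw [← hshift ω hω x hxu]
    have hreg : x + latVec ω ∈ Reg n 1 1 := by
      constructor
      · intro j hj
        have : (x + latVec ω) j = Int.fract (x j) := by
          simp [latVec, ω, hj, Int.fract, sub_eq_add_neg]
        rw [this, abs_of_nonneg (Int.fract_nonneg _)]
        exact (Int.fract_lt_one _).le
      · rw [lastc_eq hn] at hx ⊢
        simpa [latVec, ω] using hx
    rw [Gm_eq (hsum _ (upH_of_reg zero_lt_one hreg))]
    refine (clNorm_clVec_le _).trans ?_
    refine mul_le_mul_of_nonneg_left ?_ (Nat.cast_nonneg _)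
    exact tsum_of_norm_bounded hb.hasSum fun v => hb' v _ hreg
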